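/- arXiv:1508.07543 — 2 statements merged into one kernel-verified Lean document; each statement's English description precedes it below -/
import Mathlib

section
/- For every x ∈ ℤ^d and all j, k ∈ {1,…,d} with j < k: φ(x+e_j, x) + φ(x+e_j+e_k, x+e_j) + φ(x+e_k, x+e_j+e_k) + φ(x, x+e_k) = (−1)^{x_j + x_k} · θ_{j,k} (equality in ℝ). -/
open scoped Classical

/-- The phase function `φ : ℤ^d × ℤ^d → ℝ`. -/
noncomputable def phifn (d L : ℕ) (θ : Fin d → Fin d → ℝ) (ε : Fin d → ℝ)
    (x y : Fin d → ℤ) : ℝ :=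
  if ∃ j : Fin d, ∀ l : Fin d, (2 * (L : ℤ)) ∣ (x l - y l - if l = j then 1 else 0) then
    ∑ j : Fin d,
      if ∀ l : Fin d, (2 * (L : ℤ)) ∣ (x l - y l - if l = j then 1 else 0) then
        (-1 : ℝ) ^ (x j + 1) * (∑ l : Fin d, if l < j ∧ Odd (x l) then θ l j else 0) +
          (if Even (x j) then 1 else 0) * (Real.pi / (L : ℝ)) * ε j
      else 0
  else if ∃ j : Fin d, ∀ l : Fin d, (2 * (L : ℤ)) ∣ (x l - y l + if l = j then 1 else 0) then
    ∑ j : Fin d,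
      if ∀ l : Fin d, (2 * (L : ℤ)) ∣ (x l - y l + if l = j then 1 else 0) then
        (-1 : ℝ) ^ (x j + 1) * (∑ l : Fin d, if l < j ∧ Odd (x l) then θ l j else 0) -
          (if Odd (x j) then 1 else 0) * (Real.pi / (L : ℝ)) * ε j
      else 0
  else 0

theorem dvd_unit_aux (d L : ℕ) (hL : 1 ≤ L) (j i : Fin d) :
    (∀ l : Fin d, (2 * (L : ℤ)) ∣ ((if l = j then 1 else 0) - if l = i then 1 else 0)) ↔ i = j := by
  constructor
  · intro h
    by_contra hne
    have h1 := h i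
    rw [if_neg hne, if_pos rfl] at h1
    obtain ⟨c, hc⟩ := h1
    have h2 : (2 : ℤ) ∣ 0 - 1 := ⟨L * c, by rw [hc]; ring⟩
    omega
  · rintro rfl l
    simp

theorem phifn_up (d L : ℕ) (hL : 1 ≤ L) (θ : Fin d → Fin d → ℝ) (ε : Fin d → ℝ)
    (x y : Fin d → ℤ) (j : Fin d) (h : ∀ l, x l - y l = if l = j then 1 else 0) :
    phifn d L θ ε x y =
      (-1 : ℝ) ^ (x j + 1) * (∑ l : Fin d, if l < j ∧ Odd (x l) then θ l j else 0) +
          (if Even (x j) then 1 else 0) * (Real.pi / (L : ℝ)) * ε j := by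
  unfold phifn
  simp only [h, dvd_unit_aux d L hL j]
  rw [if_pos ⟨j, rfl⟩, Finset.sum_ite_eq' Finset.univ j]
  simp

theorem phifn_down (d L : ℕ) (hL : 1 ≤ L) (θ : Fin d → Fin d → ℝ) (ε : Fin d → ℝ)
    (hε1 : L = 1 → ∀ j, ε j = 0)
    (x y : Fin d → ℤ) (j : Fin d) (h : ∀ l, x l - y l = - if l = j then 1 else 0) :
    phifn d L θ ε x y =
      (-1 : ℝ) ^ (x j + 1) * (∑ l : Fin d, if l < j ∧ Odd (x l) then θ l j else 0) -
          (if Odd (x j) then 1 else 0) * (Real.pi / (L : ℝ)) * ε j := by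
  have key : ∀ i : Fin d, (∀ l : Fin d, (2 * (L : ℤ)) ∣
      ((-if l = j then 1 else 0) + if l = i then 1 else 0)) ↔ i = j := by
    intro i
    rw [← dvd_unit_aux d L hL j i]
    refine forall_congr' fun l => ?_
    rw [← dvd_neg]
    ring_nf
  unfold phifn
  simp only [h, key]
  by_cases hL1 : L = 1
  · have key2 : ∀ i : Fin d, (∀ l : Fin d, (2 * (L : ℤ)) ∣
        ((-if l = j then 1 else 0) - if l = i then 1 else 0)) ↔ i = j := by
      intro i
      rw [← dvd_unit_aux d L hL j i]
      refine forall_congr' fun l => ?_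
      subst hL1
      split_ifs <;> norm_num
    simp only [key2]
    rw [if_pos ⟨j, rfl⟩, Finset.sum_ite_eq' Finset.univ j]
    simp [hε1 hL1]
  · rw [if_neg, if_pos ⟨j, rfl⟩, Finset.sum_ite_eq' Finset.univ j]
    · simp
    · rintro ⟨i, hi⟩
      have h1 := hi j
      rw [if_pos rfl, ← dvd_neg] at h1
      have h2 := Int.le_of_dvd (by split_ifs <;> norm_num) h1
      split_ifs at h2 <;> omega

/-- Lemma 2.5 (3): the flux of `φ` through the plaquette at `x` spanned by `e_j, e_k`
equals `(-1)^{x_j + x_k} θ_{j,k}`. -/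
theorem phifn_plaquette_flux (d L : ℕ) (hd : 2 ≤ d) (hL : 1 ≤ L)
    (θ : Fin d → Fin d → ℝ) (ε : Fin d → ℝ)
    (hε : ∀ j, ε j = 0 ∨ ε j = 1) (hε1 : L = 1 → ∀ j, ε j = 0)
    (x : Fin d → ℤ) (j k : Fin d) (hjk : j < k) :
    phifn d L θ ε (fun l => x l + if l = j then 1 else 0) x +
      phifn d L θ ε (fun l => x l + (if l = j then 1 else 0) + if l = k then 1 else 0)
        (fun l => x l + if l = j then 1 else 0) +
      phifn d L θ ε (fun l => x l + if l = k then 1 else 0)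
        (fun l => x l + (if l = j then 1 else 0) + if l = k then 1 else 0) +
      phifn d L θ ε x (fun l => x l + if l = k then 1 else 0) =
    (-1 : ℝ) ^ (x j + x k) * θ j k := by
  have hne : j ≠ k := ne_of_lt hjk
  rw [phifn_up d L hL θ ε _ x j (by intro l; ring),
    phifn_up d L hL θ ε _ _ k (by intro l; ring),
    phifn_down d L hL θ ε hε1 _ _ j (by intro l; ring),
    phifn_down d L hL θ ε hε1 _ _ k (by intro l; ring)]
  have hA : (∑ l : Fin d, if l < j ∧ Odd (x l + if l = j then 1 else 0) then θ l j else 0)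
      = ∑ l : Fin d, if l < j ∧ Odd (x l) then θ l j else 0 := by
    refine Finset.sum_congr rfl fun l _ => ?_
    by_cases hl : l < j
    · rw [if_neg (ne_of_lt hl), add_zero]
    · simp [hl]
  have hA' : (∑ l : Fin d, if l < j ∧ Odd (x l + if l = k then 1 else 0) then θ l j else 0)
      = ∑ l : Fin d, if l < j ∧ Odd (x l) then θ l j else 0 := by
    refine Finset.sum_congr rfl fun l _ => ?_
    by_cases hl : l < j
    · rw [if_neg (ne_of_lt (hl.trans hjk)), add_zero]
    · simp [hl]
  have hB : (∑ l : Fin d, if l < k ∧ Odd (x l + (if l = j then 1 else 0) + if l = k then 1 else 0)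
        then θ l k else 0)
      = (∑ l : Fin d, if l < k ∧ Odd (x l) then θ l k else 0) + (-1 : ℝ) ^ (x j) * θ j k := by
    have : (-1 : ℝ) ^ (x j) * θ j k
        = ∑ l : Fin d, if l = j then (-1 : ℝ) ^ (x j) * θ j k else 0 := by simp
    rw [this, ← Finset.sum_add_distrib]
    refine Finset.sum_congr rfl fun l _ => ?_
    by_cases hl : l < k
    · rw [if_neg (ne_of_lt hl), add_zero]
      by_cases hlj : l = j
      · subst hlj
        rcases Int.even_or_odd (x l) with he | ho
        · have h1 : ¬ Odd (x l) := Int.not_odd_iff_even.mpr he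
          simp [hl, h1, he.add_one, he.neg_one_zpow]
        · have h1 : ¬ Odd (x l + 1) := Int.not_odd_iff_even.mpr ho.add_one
          simp [hl, h1, ho, ho.neg_one_zpow]
      · simp [hlj]
    · have : l ≠ j := fun e => hl (e ▸ hjk)
      simp [hl, this]
  rw [hA, hA', hB]
  have hev : ∀ n : ℤ, Even (n + 1) ↔ Odd n := by
    intro n
    rw [Int.even_add_one, Int.not_even_iff_odd]
  have h0 : (-1 : ℝ) ≠ 0 := by norm_num
  simp only [if_true, if_neg hne, if_neg hne.symm, add_zero, hev, zpow_add₀ h0, zpow_one]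
  ring
end

section
/- For every m ∈ ℕ with m ≥ 1 and every bi-anti-symmetric function f_m : S^m × S^m → ℂ: Σ_{X,Y ∈ S^m} f_m(X,Y) · a_X^* · a_Y = Σ_{l=0}^{m} (−1)^{m−l} · (binom(m,l))² · l! · Σ_{X,Y ∈ S^{m−l}} Σ_{Z ∈ S^{l}} f_m((X,Z),(Z̃,Y)) · a_Y · a_X^*, where (X,Z) denotes concatenation of tuples, Z̃ := (z_l, z_{l−1}, …, z_1) is the reversal of Z = (z_1,…,z_l), and products over empty tuples are the identity 1 of A. -/
/-- Gluing of two tuples: the first `p` entries come from `X`, the remaining ones from `Z`. -/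
def glue {α : Type*} {m p : ℕ} (X : Fin p → α) (Z : Fin (m - p) → α) : Fin m → α :=
  fun i =>
    if h : (i : ℕ) < p then X ⟨i, h⟩
    else Z ⟨(i : ℕ) - p, by have := i.isLt; omega⟩

/-- The ordered product `a_{X 0} * a_{X 1} * ⋯ * a_{X (m-1)}`. -/
def seqProd {A : Type*} [Ring A] {n m : ℕ} (a : Fin n → A) (X : Fin m → Fin n) : A :=
  (List.ofFn fun i => a (X i)).prod


namespace CarAux

open Finset

/-- Sum of `g` over all lists of length `p`. -/
def sumL {M : Type*} [AddCommMonoid M] {n : ℕ} (p : ℕ) (g : List (Fin n) → M) : M :=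
  ∑ X : Fin p → Fin n, g (List.ofFn X)

section
variable {M : Type*} [AddCommMonoid M] {n : ℕ}

lemma sumL_zero (g : List (Fin n) → M) : sumL 0 g = g [] := by
  simp [sumL]

lemma sumL_succ (p : ℕ) (g : List (Fin n) → M) :
    sumL (p + 1) g = ∑ x, sumL p (fun L => g (x :: L)) := by
  unfold sumL
  rw [← (Fin.consEquiv (fun _ => Fin n)).sum_comp, Fintype.sum_prod_type]
  simp [Fin.consEquiv, List.ofFn_succ]

lemma sumL_congr {p : ℕ} {g h : List (Fin n) → M} (H : ∀ L, L.length = p → g L = h L) :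
    sumL p g = sumL p h :=
  Finset.sum_congr rfl fun X _ => H _ (by simp)

lemma sumL_sum {ι : Type*} (s : Finset ι) (p : ℕ) (g : ι → List (Fin n) → M) :
    sumL p (fun L => ∑ i ∈ s, g i L) = ∑ i ∈ s, sumL p (g i) :=
  Finset.sum_comm

lemma sumL_comm (p q : ℕ) (g : List (Fin n) → List (Fin n) → M) :
    sumL p (fun L => sumL q (g L)) = sumL q (fun K => sumL p (fun L => g L K)) :=
  Finset.sum_comm

lemma sumL_add (p : ℕ) (g h : List (Fin n) → M) :
    sumL p (fun L => g L + h L) = sumL p g + sumL p h :=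
  Finset.sum_add_distrib

lemma sumL_snoc (p : ℕ) (g : List (Fin n) → M) :
    sumL (p + 1) g = ∑ x, sumL p (fun L => g (L ++ [x])) := by
  induction p generalizing g with
  | zero => simp [sumL_succ, sumL_zero]
  | succ k ih =>
    rw [sumL_succ, Finset.sum_congr rfl fun x _ => ih (fun L => g (x :: L)), Finset.sum_comm]
    exact Finset.sum_congr rfl fun x _ => (sumL_succ k (fun L => g (L ++ [x]))).symm

end

section
variable {A : Type*} [Ring A] [Algebra ℂ A] {n : ℕ}

lemma mul_sumL (p : ℕ) (b : A) (g : List (Fin n) → A) :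
    b * sumL p g = sumL p (fun L => b * g L) := Finset.mul_sum _ _ _

lemma sumL_mul (p : ℕ) (b : A) (g : List (Fin n) → A) :
    sumL p g * b = sumL p (fun L => g L * b) := Finset.sum_mul _ _ _

lemma smul_sumL (p : ℕ) (c : ℂ) (g : List (Fin n) → A) :
    c • sumL p g = sumL p (fun L => c • g L) := Finset.smul_sum

/-- Antisymmetry under adjacent transpositions. -/
def Anti (g : List (Fin n) → ℂ) : Prop :=
  ∀ l₁ x y l₂, g (l₁ ++ x :: y :: l₂) = - g (l₁ ++ y :: x :: l₂)

lemma Anti.cons {g : List (Fin n) → ℂ} (h : Anti g) (x : Fin n) :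
    Anti (fun L => g (x :: L)) := fun l₁ y z l₂ => h (x :: l₁) y z l₂

lemma Anti.snoc {g : List (Fin n) → ℂ} (h : Anti g) (x : Fin n) :
    Anti (fun L => g (L ++ [x])) := fun l₁ y z l₂ => by
  simpa using h l₁ y z (l₂ ++ [x])

lemma Anti.move {g : List (Fin n) → ℂ} (h : Anti g) (y : Fin n) (Z l₂ : List (Fin n)) :
    g (y :: (Z ++ l₂)) = (-1) ^ Z.length * g (Z ++ y :: l₂) := by
  induction Z generalizing g with
  | nil => simp
  | cons z Z ih =>
    have h1 := h [] y z (Z ++ l₂)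
    have h2 := ih (h.cons z)
    simp only [List.nil_append, List.cons_append, List.length_cons] at *
    rw [h1, h2]; ring

/-- Ordered product over a list. -/
def lp (a : Fin n → A) (L : List (Fin n)) : A := (L.map a).prod

lemma lp_cons (a : Fin n → A) (x : Fin n) (L : List (Fin n)) :
    lp a (x :: L) = a x * lp a L := by simp [lp]

lemma lp_nil (a : Fin n → A) : lp a [] = 1 := by simp [lp]

lemma move_one (a astar : Fin n → A)
    (hCAR1 : ∀ j k : Fin n, astar j * a k + a k * astar j = if j = k then 1 else 0)
    (p : ℕ) (y : Fin n) (g : List (Fin n) → ℂ) (hg : Anti g) :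
    sumL p (fun X => g X • (lp astar X * a y)) =
      (-1 : ℂ) ^ p • sumL p (fun X => g X • (a y * lp astar X)) +
      (p : ℂ) • sumL (p - 1) (fun X => g (X ++ [y]) • lp astar X) := by
  induction p generalizing g with
  | zero => simp [sumL_zero, lp_nil]
  | succ p ih =>
    have hc : ∀ x, astar x * a y = (if x = y then 1 else 0) - a y * astar x := fun x => by
      rw [← hCAR1]; abel
    have e1 : ∀ x, sumL p (fun X => g (x :: X) • (lp astar (x :: X) * a y)) =
        (if x = y then (-1 : ℂ) ^ p • sumL p (fun X => g (x :: X) • lp astar X) else 0)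
        + (-1 : ℂ) ^ (p + 1) • sumL p (fun X => g (x :: X) • (a y * lp astar (x :: X)))
        + (p : ℂ) • sumL (p - 1) (fun X => g (x :: X ++ [y]) • lp astar (x :: X)) := by
      intro x
      have h1 : sumL p (fun X => g (x :: X) • (lp astar (x :: X) * a y)) =
          astar x * sumL p (fun X => g (x :: X) • (lp astar X * a y)) := by
        rw [mul_sumL]
        refine sumL_congr fun L _ => ?_
        rw [lp_cons, mul_smul_comm, mul_assoc]
      rw [h1, ih _ (hg.cons x), mul_add, mul_smul_comm, mul_smul_comm, mul_sumL, mul_sumL]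
      congr 1
      · split_ifs with hxy
        · rw [pow_succ, mul_neg_one, neg_smul, ← smul_neg, ← smul_add]
          congr 1
          rw [← neg_one_smul ℂ (sumL p _), smul_sumL, ← sumL_add]
          refine sumL_congr fun L _ => ?_
          rw [mul_smul_comm, ← mul_assoc, hc, if_pos hxy, lp_cons, smul_comm, ← smul_add]
          congr 1
          rw [sub_mul, one_mul, mul_assoc, neg_one_smul, sub_eq_add_neg]
        · rw [zero_add, pow_succ, mul_smul]
          congr 1
          rw [smul_sumL]
          refine sumL_congr fun L _ => ?_
          rw [mul_smul_comm, ← mul_assoc, hc, if_neg hxy, lp_cons, smul_comm]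
          congr 1
          rw [zero_sub, neg_mul, mul_assoc, neg_one_smul]
      · congr 1
        refine sumL_congr fun L _ => ?_
        rw [mul_smul_comm, lp_cons]; simp
    have e2 : (-1 : ℂ) ^ p • sumL p (fun X => g (y :: X) • lp astar X) =
        sumL p (fun X => g (X ++ [y]) • lp astar X) := by
      rw [smul_sumL]
      refine sumL_congr fun L hL => ?_
      have := hg.move y L []
      rw [List.append_nil] at this
      rw [this, hL, smul_smul, ← mul_assoc, ← mul_pow]
      simp
    have e3 : (p : ℂ) • ∑ x, sumL (p - 1) (fun X => g (x :: X ++ [y]) • lp astar (x :: X)) =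
        (p : ℂ) • sumL p (fun X => g (X ++ [y]) • lp astar X) := by
      cases p with
      | zero => simp
      | succ k => rw [sumL_succ]; simp
    rw [sumL_succ]
    simp_rw [e1]
    rw [Finset.sum_add_distrib, Finset.sum_add_distrib, ← Finset.smul_sum, ← Finset.smul_sum, e3,
      ← sumL_succ p (fun X => g X • (a y * lp astar X))]
    simp only [Finset.sum_ite_eq', Finset.mem_univ, if_true]
    rw [e2]
    simp only [Nat.add_sub_cancel, Nat.cast_succ, add_smul, one_smul]
    abel

/-- The contracted sum. -/
def T (a astar : Fin n → A) (p q l : ℕ) (f : List (Fin n) → List (Fin n) → ℂ) : A :=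
  sumL p fun X => sumL q fun Y => sumL l fun Z =>
    f (X ++ Z) (Z.reverse ++ Y) • (lp a Y * lp astar X)

lemma T_first (a astar : Fin n → A) (p q l : ℕ) (f : List (Fin n) → List (Fin n) → ℂ)
    (h2 : ∀ X, Anti (f X)) :
    ∑ y, a y * T a astar p q l (fun X Y => f X (y :: Y)) =
      (-1 : ℂ) ^ l • T a astar p (q + 1) l f := by
  unfold T
  simp_rw [mul_sumL, smul_sumL, sumL_succ q]
  rw [← sumL_sum]
  refine sumL_congr fun X _ => ?_
  refine Finset.sum_congr rfl fun y _ => ?_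
  refine sumL_congr fun Y _ => ?_
  refine sumL_congr fun Z hZ => ?_
  rw [(h2 _).move y Z.reverse Y, List.length_reverse, hZ, mul_smul_comm, lp_cons, smul_smul,
    mul_assoc]

lemma T_second (a astar : Fin n → A) (p q l : ℕ) (f : List (Fin n) → List (Fin n) → ℂ) :
    ∑ y, T a astar p q l (fun X Y => f (X ++ [y]) (y :: Y)) = T a astar p q (l + 1) f := by
  unfold T
  simp_rw [sumL_snoc l, sumL_sum]
  simp

lemma main (a astar : Fin n → A)
    (hCAR1 : ∀ j k : Fin n, astar j * a k + a k * astar j = if j = k then 1 else 0)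
    (q : ℕ) : ∀ (p : ℕ) (f : List (Fin n) → List (Fin n) → ℂ)
    (_ : ∀ Y, Anti (fun X => f X Y)) (_ : ∀ X, Anti (f X)),
    sumL p (fun X => sumL q fun Y => f X Y • (lp astar X * lp a Y)) =
      ∑ l ∈ range (q + 1), ((-1 : ℂ) ^ ((p - l) * (q - l)) * (p.choose l) * (q.choose l)
        * (l.factorial)) • T a astar (p - l) (q - l) l f := by
  induction q with
  | zero =>
    intro p f _ _
    simp [T, sumL_zero, lp_nil]
  | succ q ih =>
    intro p f h1 h2
    have e1 : sumL p (fun X => sumL (q + 1) fun Y => f X Y • (lp astar X * lp a Y)) =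
        (-1 : ℂ) ^ p • ∑ y, a y * sumL p (fun X => sumL q fun Y =>
            f X (y :: Y) • (lp astar X * lp a Y)) +
        (p : ℂ) • ∑ y, sumL (p - 1) (fun X => sumL q fun Y =>
            f (X ++ [y]) (y :: Y) • (lp astar X * lp a Y)) := by
      simp_rw [sumL_succ q]
      rw [sumL_sum, Finset.smul_sum, Finset.smul_sum, ← Finset.sum_add_distrib]
      refine Finset.sum_congr rfl fun y _ => ?_
      rw [sumL_comm, sumL_comm p q, sumL_comm (p - 1) q, mul_sumL, smul_sumL, smul_sumL,
        ← sumL_add]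
      refine sumL_congr fun Y _ => ?_
      have := congrArg (· * lp a Y) (move_one a astar hCAR1 p y (fun X => f X (y :: Y)) (h1 _))
      simp only [add_mul, smul_mul_assoc, sumL_mul] at this
      rw [mul_sumL]
      simp only [mul_smul_comm, lp_cons, ← mul_assoc]
      exact this
    rw [e1]
    have e2 : ∀ y, _ := fun y => ih p (fun X Y => f X (y :: Y)) (fun Y => h1 (y :: Y))
      (fun X => (h2 X).cons y)
    have e3 : ∀ y, _ := fun y => ih (p - 1) (fun X Y => f (X ++ [y]) (y :: Y))
      (fun Y => (h1 (y :: Y)).snoc y) (fun X => (h2 _).cons y)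
    simp_rw [e2, e3, Finset.mul_sum, mul_smul_comm]
    rw [Finset.sum_comm, Finset.sum_comm (s := univ)]
    simp_rw [← Finset.smul_sum, T_first _ _ _ _ _ _ h2, T_second, Finset.smul_sum, smul_smul]
    have e4 : ∑ l ∈ range (q + 1), ((-1 : ℂ) ^ p * ((-1 : ℂ) ^ ((p - l) * (q - l))
          * (p.choose l) * (q.choose l) * (l.factorial) * (-1) ^ l)) •
          T a astar (p - l) (q - l + 1) l f =
        ∑ l ∈ range (q + 2), ((-1 : ℂ) ^ ((p - l) * (q + 1 - l))
          * (p.choose l) * (q.choose l) * (l.factorial)) •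
          T a astar (p - l) (q + 1 - l) l f := by
      rw [Finset.sum_range_succ _ (q + 1)]
      simp only [Nat.choose_succ_self, Nat.cast_zero, mul_zero, zero_mul, zero_smul, add_zero]
      refine Finset.sum_congr rfl fun l hl => ?_
      have hl' : l ≤ q := by simpa [Nat.lt_succ_iff] using hl
      have hs : q + 1 - l = q - l + 1 := by omega
      rw [hs]
      congr 1
      rcases le_or_gt l p with hp | hp
      · obtain ⟨k, rfl⟩ := Nat.exists_eq_add_of_le hp
        have : (-1 : ℂ) ^ (l + k) * (-1) ^ l = (-1) ^ k := by
          rw [← pow_add, show l + k + l = 2 * l + k by ring, pow_add, pow_mul]; simp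
        simp only [Nat.add_sub_cancel_left, mul_add, mul_one]
        rw [pow_add _ (k * (q - l)) k, ← this]
        ring
      · simp [Nat.choose_eq_zero_of_lt hp]
    have e5 : ∑ l ∈ range (q + 1), ((p : ℂ) * ((-1 : ℂ) ^ ((p - 1 - l) * (q - l))
          * ((p - 1).choose l) * (q.choose l) * (l.factorial))) •
          T a astar (p - 1 - l) (q - l) (l + 1) f =
        ∑ l ∈ range (q + 1), ((-1 : ℂ) ^ ((p - (l + 1)) * (q + 1 - (l + 1)))
          * (p.choose (l + 1)) * (q.choose l) * ((l + 1).factorial)) •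
          T a astar (p - (l + 1)) (q + 1 - (l + 1)) (l + 1) f := by
      refine Finset.sum_congr rfl fun l hl => ?_
      have hs : p - (l + 1) = p - 1 - l := by omega
      rw [hs, Nat.add_sub_add_right]
      congr 1
      cases p with
      | zero => simp
      | succ p =>
        have := Nat.add_one_mul_choose_eq p l
        have : ((p : ℂ) + 1) * (p.choose l) = ((p + 1).choose (l + 1)) * (l + 1) := by
          exact_mod_cast this
        simp only [Nat.add_sub_cancel, Nat.factorial_succ]
        push_cast
        linear_combination ((-1 : ℂ) ^ ((p - l) * (q - l)) * (q.choose l) * l.factorial) * this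
    rw [e4, e5, Finset.sum_range_succ' _ (q + 1), Finset.sum_range_succ' _ (q + 1),
      add_right_comm, ← Finset.sum_add_distrib]
    congr 1
    · refine Finset.sum_congr rfl fun l hl => ?_
      rw [← add_smul]
      congr 1
      rw [Nat.choose_succ_succ q l]
      push_cast
      ring
    · simp

/-- Turning a list into a tuple. -/
def tup (d : Fin n) (m : ℕ) (L : List (Fin n)) : Fin m → Fin n := fun i => L.getD i d

lemma tup_swap (d : Fin n) (m : ℕ) (l₁ l₂ : List (Fin n)) (x y : Fin n)
    (h : (l₁ ++ x :: y :: l₂).length = m) :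
    ∃ σ : Equiv.Perm (Fin m), Equiv.Perm.sign σ = -1 ∧
      tup d m (l₁ ++ x :: y :: l₂) = tup d m (l₁ ++ y :: x :: l₂) ∘ σ := by
  have hl : l₁.length + 1 < m := by simp at h; omega
  refine ⟨Equiv.swap ⟨l₁.length, by omega⟩ ⟨l₁.length + 1, hl⟩, ?_, ?_⟩
  · apply Equiv.Perm.sign_swap
    simp
  · funext i
    rcases lt_trichotomy (i : ℕ) l₁.length with hi | hi | hi
    · rw [Function.comp_apply, Equiv.swap_apply_of_ne_of_ne]
      · simp only [tup]
        rw [List.getD_append _ _ _ _ hi, List.getD_append _ _ _ _ hi]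
      · intro e; simp [e] at hi
      · intro e; simp [e] at hi
    · have : i = ⟨l₁.length, by omega⟩ := Fin.ext hi
      rw [this, Function.comp_apply, Equiv.swap_apply_left]
      simp [tup, List.getD_append_right]
    · rcases Nat.eq_or_lt_of_le hi with hi2 | hi2
      · have : i = ⟨l₁.length + 1, hl⟩ := Fin.ext hi2.symm
        subst this
        rw [Function.comp_apply, Equiv.swap_apply_right]
        simp [tup, List.getD_append_right]
      · rw [Function.comp_apply, Equiv.swap_apply_of_ne_of_ne]
        · obtain ⟨k, hk⟩ := Nat.exists_eq_add_of_lt hi2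
          have hk' : (i : ℕ) - l₁.length = k + 2 := by omega
          simp only [tup]
          rw [List.getD_append_right _ _ _ _ (by omega), List.getD_append_right _ _ _ _ (by omega),
            hk']
          simp
        · intro e; simp [e] at hi
        · intro e; simp [e] at hi2

lemma tup_ofFn (d : Fin n) (m : ℕ) (X : Fin m → Fin n) : tup d m (List.ofFn X) = X := by
  funext i
  simp [tup, List.getD_eq_getElem?_getD]

lemma lp_ofFn (a : Fin n → A) {m : ℕ} (X : Fin m → Fin n) : lp a (List.ofFn X) = seqProd a X := by
  simp [lp, seqProd, List.map_ofFn, Function.comp_def]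

end

end CarAux

open CarAux in
/-- Lemma A.1: reordering of a bi-anti-symmetrized sum of monomials in a CAR algebra. -/
theorem car_reordering (n : ℕ) (hn : 1 ≤ n) (A : Type*) [Ring A] [Algebra ℂ A]
    (a astar : Fin n → A)
    (hCAR1 : ∀ j k : Fin n, astar j * a k + a k * astar j = if j = k then 1 else 0)
    (hCAR2 : ∀ j k : Fin n, a j * a k + a k * a j = 0)
    (hCAR3 : ∀ j k : Fin n, astar j * astar k + astar k * astar j = 0)
    (m : ℕ) (hm : 1 ≤ m) (f : (Fin m → Fin n) → (Fin m → Fin n) → ℂ)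
    (hf : ∀ (σ τ : Equiv.Perm (Fin m)) (X Y : Fin m → Fin n),
      f (X ∘ σ) (Y ∘ τ) =
        ((Equiv.Perm.sign σ : ℤ) : ℂ) * ((Equiv.Perm.sign τ : ℤ) : ℂ) * f X Y) :
    ∑ X : Fin m → Fin n, ∑ Y : Fin m → Fin n, f X Y • (seqProd astar X * seqProd a Y) =
      ∑ l : Fin (m + 1),
        ((-1 : ℂ) ^ (m - (l : ℕ)) * (m.choose (l : ℕ) : ℂ) ^ 2 * ((l : ℕ).factorial : ℂ)) •
          ∑ X : Fin (m - (l : ℕ)) → Fin n, ∑ Y : Fin (m - (l : ℕ)) → Fin n,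
            ∑ Z : Fin (l : ℕ) → Fin n,
              f (glue (m := m) X fun i =>
                  Z (Fin.cast (by have := l.is_le; omega : m - (m - (l : ℕ)) = (l : ℕ)) i))
                (glue (m := m)
                  (fun i : Fin (l : ℕ) => Z ⟨(l : ℕ) - 1 - (i : ℕ), by have := i.isLt; omega⟩)
                  (fun i => Y i)) •
              (seqProd a Y * seqProd astar X) := by
  classical
  let d : Fin n := ⟨0, hn⟩
  let F : List (Fin n) → List (Fin n) → ℂ := fun L K =>
    if L.length = m ∧ K.length = m then f (tup d m L) (tup d m K) else 0
  have hF1 : ∀ Y, Anti (fun X => F X Y) := by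
    intro Y l₁ x y l₂
    simp only [F]
    by_cases h : (l₁ ++ x :: y :: l₂).length = m ∧ Y.length = m
    · have h' : (l₁ ++ y :: x :: l₂).length = m ∧ Y.length = m := by simpa using h
      rw [if_pos h, if_pos h']
      obtain ⟨σ, hσ, e⟩ := tup_swap d m l₁ l₂ x y h.1
      have := hf σ 1 (tup d m (l₁ ++ y :: x :: l₂)) (tup d m Y)
      rw [e]
      simpa [hσ] using this
    · have h' : ¬ ((l₁ ++ y :: x :: l₂).length = m ∧ Y.length = m) := by simpa using h
      rw [if_neg h, if_neg h', neg_zero]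
  have hF2 : ∀ X, Anti (F X) := by
    intro X l₁ x y l₂
    simp only [F]
    by_cases h : X.length = m ∧ (l₁ ++ x :: y :: l₂).length = m
    · have h' : X.length = m ∧ (l₁ ++ y :: x :: l₂).length = m := by simpa using h
      rw [if_pos h, if_pos h']
      obtain ⟨σ, hσ, e⟩ := tup_swap d m l₁ l₂ x y h.2
      have := hf 1 σ (tup d m X) (tup d m (l₁ ++ y :: x :: l₂))
      rw [e]
      simpa [hσ] using this
    · have h' : ¬ (X.length = m ∧ (l₁ ++ y :: x :: l₂).length = m) := by simpa using h
      rw [if_neg h, if_neg h', neg_zero]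
  have key := main a astar hCAR1 m m F hF1 hF2
  rw [← Fin.sum_univ_eq_sum_range (fun l => ((-1 : ℂ) ^ ((m - l) * (m - l)) * (m.choose l)
    * (m.choose l) * (l.factorial)) • T a astar (m - l) (m - l) l F)] at key
  have hL : sumL m (fun X => sumL m fun Y => F X Y • (lp astar X * lp a Y)) =
      ∑ X : Fin m → Fin n, ∑ Y : Fin m → Fin n, f X Y • (seqProd astar X * seqProd a Y) := by
    unfold sumL
    simp [F, tup_ofFn, lp_ofFn]
  rw [← hL, key]
  refine Finset.sum_congr rfl fun l _ => ?_
  have hlm : (l : ℕ) ≤ m := l.is_le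
  congr 1
  · have : (-1 : ℂ) ^ ((m - (l : ℕ)) * (m - (l : ℕ))) = (-1) ^ (m - (l : ℕ)) := by
      rcases Nat.even_or_odd (m - (l : ℕ)) with h | h
      · rw [h.neg_one_pow, (h.mul_left _).neg_one_pow]
      · rw [h.neg_one_pow, (h.mul h).neg_one_pow]
    rw [this]; ring
  · unfold T sumL
    refine Finset.sum_congr rfl fun X _ => ?_
    refine Finset.sum_congr rfl fun Y _ => ?_
    refine Finset.sum_congr rfl fun Z _ => ?_
    rw [lp_ofFn, lp_ofFn]
    congr 1
    simp only [F]
    rw [if_pos (by simp; omega)]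
    refine congrArg (fun c : ℂ => c • (seqProd a Y * seqProd astar X)) (congrArg₂ f ?_ ?_)
    · funext i
      simp only [tup, glue]
      split_ifs with h
      · rw [List.getD_append _ _ _ _ (by simpa using h), List.getD_eq_getElem _ _ (by simpa using h)]
        simp
      · have hi := i.isLt
        rw [List.getD_append_right _ _ _ _ (by simpa using h),
          List.getD_eq_getElem _ _ (by simp; omega)]
        simp
    · funext i
      simp only [tup, glue]
      split_ifs with h
      · rw [List.getD_append _ _ _ _ (by simpa using h), List.getD_eq_getElem _ _ (by simpa using h)]
        simp
      · have hi := i.isLt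
        rw [List.getD_append_right _ _ _ _ (by simpa using h),
          List.getD_eq_getElem _ _ (by simp; omega)]
        simp
end
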